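/- Let H be a real Hilbert space, let A ⊆ H be a nonempty, convex, closed and bounded subset, let G : H → ℝ be convex on A and continuous on A, let ρ > 0 and a* ∈ H, and let a_ρ ∈ A be the unique minimizer over A of a ↦ G(a) + ρ‖a − a*‖². Let (G_n) be a sequence of functions G_n : H → ℝ such that sup_{a ∈ A} |G_n(a) − G(a)| → 0 as n → ∞, and suppose for each n there exists a_n ∈ A minimizing a ↦ G_n(a) + ρ‖a − a*‖² over A. Then ‖a_n − a_ρ‖ → 0 as n → ∞. -/

import Mathlib

open Filter

/-- A minimizer of a convex functional plus a squared-distance penalty satisfies a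
quadratic growth estimate. -/
theorem ConvexOn.mul_norm_sub_sq_le_of_forall_le
    {H : Type*} [NormedAddCommGroup H] [InnerProductSpace ℝ H] {A : Set H} {G : H → ℝ}
    (hG : ConvexOn ℝ A G) {ρ : ℝ} {c x : H} (hx : x ∈ A)
    (hmin : ∀ a ∈ A, G x + ρ * ‖x - c‖ ^ 2 ≤ G a + ρ * ‖a - c‖ ^ 2)
    {y : H} (hy : y ∈ A) :
    ρ / 2 * ‖y - x‖ ^ 2 ≤ (G y + ρ * ‖y - c‖ ^ 2) - (G x + ρ * ‖x - c‖ ^ 2) := by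
  have half_nonneg : (0 : ℝ) ≤ 1 / 2 := by norm_num
  have half_add_half : (1 / 2 : ℝ) + 1 / 2 = 1 := by norm_num
  have hmid := hmin _ (hG.1 hy hx half_nonneg half_nonneg half_add_half)
  have hconv := hG.2 hy hx half_nonneg half_nonneg half_add_half
  simp only [smul_eq_mul] at hconv
  have hnorm : ‖(1 / 2 : ℝ) • y + (1 / 2 : ℝ) • x - c‖ ^ 2
      = ‖y - c‖ ^ 2 / 2 + ‖x - c‖ ^ 2 / 2 - ‖y - x‖ ^ 2 / 4 := by
    have hpar := parallelogram_law_with_norm ℝ (y - c) (x - c)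
    have hdiff : y - c - (x - c) = y - x := by abel
    have hsum : (1 / 2 : ℝ) • y + (1 / 2 : ℝ) • x - c
        = (1 / 2 : ℝ) • (y - c + (x - c)) := by module
    rw [hdiff] at hpar
    rw [hsum, norm_smul, mul_pow, Real.norm_of_nonneg half_nonneg]
    linarith
  rw [hnorm] at hmid
  linarith

/-- Stability of Tikhonov regularization: if the perturbed functionals `Gₙ` converge
uniformly on `A` to `G`, then the perturbed minimizers converge in norm to the
minimizer for `G`. -/
theorem tikhonov_stability
    {H : Type*} [NormedAddCommGroup H] [InnerProductSpace ℝ H] [CompleteSpace H]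
    (A : Set H) (hA_ne : A.Nonempty) (hA_conv : Convex ℝ A) (hA_closed : IsClosed A)
    (hA_bdd : Bornology.IsBounded A)
    (G : H → ℝ) (hG_conv : ConvexOn ℝ A G) (hG_cont : ContinuousOn G A)
    (ρ : ℝ) (hρ : 0 < ρ) (astar : H)
    (aρ : H) (haρ_mem : aρ ∈ A)
    (haρ_min : ∀ a ∈ A, G aρ + ρ * ‖aρ - astar‖ ^ 2 ≤ G a + ρ * ‖a - astar‖ ^ 2)
    (Gn : ℕ → H → ℝ)
    (hGn_unif : ∀ ε > 0, ∃ N : ℕ, ∀ n ≥ N, ∀ a ∈ A, |Gn n a - G a| ≤ ε)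
    (an : ℕ → H) (han_mem : ∀ n, an n ∈ A)
    (han_min : ∀ n, ∀ a ∈ A,
      Gn n (an n) + ρ * ‖an n - astar‖ ^ 2 ≤ Gn n a + ρ * ‖a - astar‖ ^ 2) :
    Tendsto (fun n => ‖an n - aρ‖) atTop (nhds 0) := by
  refine Metric.tendsto_atTop.2 fun δ hδ => ?_
  obtain ⟨N, hN⟩ := hGn_unif (ρ * δ ^ 2 / 8) (by positivity)
  refine ⟨N, fun n hn => ?_⟩
  have hgrowth := hG_conv.mul_norm_sub_sq_le_of_forall_le haρ_mem haρ_min (han_mem n)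
  have hn_an := (abs_le.1 (hN n hn (an n) (han_mem n))).1
  have hn_aρ := (abs_le.1 (hN n hn aρ haρ_mem)).2
  have hmin := han_min n aρ haρ_mem
  have hsq : ‖an n - aρ‖ ^ 2 < δ ^ 2 := by
    have hρδ : 0 < ρ * δ ^ 2 := by positivity
    refine lt_of_mul_lt_mul_left ?_ hρ.le
    linarith
  rw [dist_zero_right, norm_norm]
  exact lt_of_pow_lt_pow_left₀ 2 hδ.le hsq
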